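/- Let G be a finite abelian group of exponent n. Then ρ(G) ≤ Σ_{d ∣ n, d > 1} (η_{(P^−(d),d)}(G) − 1)/d. -/

import Mathlib

open Multiset Finset

/-- The cross number of a sequence (multiset) over an additive group:
    the sum of the reciprocals of the orders of its elements. -/
noncomputable def crossNum {G : Type*} [AddCommGroup G] (S : Multiset G) : ℝ :=
  (S.map fun g => (1 : ℝ) / (addOrderOf g : ℝ)).sum

/-- A tiny zero-sum sequence: non-empty, zero sum, cross number at most 1. -/
def IsTinyZS {G : Type*} [AddCommGroup G] (S' : Multiset G) : Prop :=
  S' ≠ 0 ∧ S'.sum = 0 ∧ crossNum S' ≤ 1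

/-- `tC G` : the smallest `t ≥ 1` such that every sequence over `G` of length `≥ t`
    contains a tiny zero-sum subsequence. -/
noncomputable def tC (G : Type*) [AddCommGroup G] : ℕ :=
  sInf {t : ℕ | 0 < t ∧ ∀ S : Multiset G, t ≤ Multiset.card S → ∃ S' ≤ S, IsTinyZS S'}

/-- `etaC G` : the smallest `t ≥ 1` such that every sequence over `G` of length `≥ t`
    contains a non-empty zero-sum subsequence of length at most `exp(G)`. -/
noncomputable def etaC (G : Type*) [AddCommGroup G] : ℕ :=
  sInf {t : ℕ | 0 < t ∧ ∀ S : Multiset G, t ≤ Multiset.card S →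
    ∃ S' ≤ S, S' ≠ 0 ∧ S'.sum = 0 ∧ Multiset.card S' ≤ AddMonoid.exponent G}

/-- `etaDD G d' d` : the smallest `t ≥ 1` such that every sequence over
    `G_d = {x : G | d • x = 0}` of length `≥ t` contains a non-empty subsequence of length
    at most `d'` whose sum lies in `G_{d/d'}`. -/
noncomputable def etaDD (G : Type*) [AddCommGroup G] (d' d : ℕ) : ℕ :=
  sInf {t : ℕ | 0 < t ∧ ∀ S : Multiset G, (∀ g ∈ S, d • g = 0) → t ≤ Multiset.card S →
    ∃ S' ≤ S, S' ≠ 0 ∧ Multiset.card S' ≤ d' ∧ (d / d') • S'.sum = 0}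

/-- `rhoC G` : the maximum of the cross numbers of sequences over `G` containing
    no tiny zero-sum subsequence. -/
noncomputable def rhoC (G : Type*) [AddCommGroup G] : ℝ :=
  sSup {x : ℝ | ∃ S : Multiset G, (¬ ∃ S' ≤ S, IsTinyZS S') ∧ crossNum S = x}

/-- `maxPF n = P⁺(n)`, the greatest prime divisor of `n`, with `P⁺(1) = 1`. -/
def maxPF (n : ℕ) : ℕ := if n = 1 then 1 else n.primeFactors.sup id

/-- `G` is a finite abelian group of rank `r`, i.e. `G ≅ C_{n₁} ⊕ ⋯ ⊕ C_{n_r}` with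
    `1 < n₁ ∣ ⋯ ∣ n_r`. -/
def HasRank (G : Type*) [AddCommGroup G] (r : ℕ) : Prop :=
  ∃ n : Fin r → ℕ, (∀ i, 1 < n i) ∧ (∀ i j : Fin r, i ≤ j → n i ∣ n j) ∧
    Nonempty (G ≃+ ((i : Fin r) → ZMod (n i)))


section CrossNumber

variable {G : Type*} [AddCommGroup G]

theorem crossNum_zero : crossNum (0 : Multiset G) = 0 := by
  simp [crossNum]

theorem crossNum_cons (g : G) (S : Multiset G) :
    crossNum (g ::ₘ S) = 1 / (addOrderOf g : ℝ) + crossNum S := by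
  simp [crossNum]

theorem crossNum_add (S T : Multiset G) : crossNum (S + T) = crossNum S + crossNum T := by
  simp [crossNum]

theorem crossNum_eq_card_div {d : ℕ} {S : Multiset G} (h : ∀ g ∈ S, addOrderOf g = d) :
    crossNum S = (Multiset.card S : ℝ) / d := by
  have hmap : S.map (fun g => (1 : ℝ) / (addOrderOf g : ℝ)) = S.map fun _ => (1 : ℝ) / d :=
    Multiset.map_congr rfl fun g hg => by rw [h g hg]
  rw [crossNum, hmap, Multiset.map_const', Multiset.sum_replicate, nsmul_eq_mul]
  ring

/-- The cross number, computed by grouping the elements according to their orders. -/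
theorem crossNum_eq_sum_countP (D : Finset ℕ) (S : Multiset G)
    (h : ∀ g ∈ S, addOrderOf g ∈ D) :
    crossNum S = ∑ d ∈ D, (S.countP (fun g => addOrderOf g = d) : ℝ) / d := by
  induction S using Multiset.induction_on with
  | empty => simp [crossNum_zero]
  | cons a S ih =>
    have ha := h a (Multiset.mem_cons_self a S)
    rw [crossNum_cons, ih fun g hg => h g (Multiset.mem_cons_of_mem hg)]
    simp only [Multiset.countP_cons, Nat.cast_add, add_div, Finset.sum_add_distrib]
    rw [add_comm, add_right_inj, Finset.sum_eq_single_of_mem _ ha]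
    · simp
    · intro b _ hb
      simp [hb.symm]

theorem isTinyZS_singleton_zero : IsTinyZS ({0} : Multiset G) := by
  simp [IsTinyZS, crossNum]

/-- Replacing a nonempty subsequence by its sum creates no tiny zero-sum subsequence, as long as
the cross number does not decrease. -/
theorem exists_isTinyZS_of_sum_cons {A B : Multiset G} (hA : A ≠ 0)
    (hk : crossNum A ≤ 1 / (addOrderOf A.sum : ℝ))
    (h : ∃ U ≤ A.sum ::ₘ B, IsTinyZS U) : ∃ U ≤ A + B, IsTinyZS U := by
  classical
  obtain ⟨U, hU, htiny⟩ := h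
  by_cases hmem : A.sum ∈ U
  · obtain ⟨V, rfl⟩ := Multiset.exists_cons_of_mem hmem
    obtain ⟨-, hsum, hcross⟩ := htiny
    rw [Multiset.sum_cons] at hsum
    rw [crossNum_cons] at hcross
    refine ⟨A + V, add_le_add_right ((Multiset.cons_le_cons_iff _).1 hU) A, ?_, ?_, ?_⟩
    · simp [hA]
    · rwa [Multiset.sum_add]
    · rw [crossNum_add]
      linarith
  · exact ⟨U, ((Multiset.le_cons_of_notMem hmem).1 hU).trans (Multiset.le_add_left _ _), htiny⟩

theorem etaDD_set_nonempty [Finite G] {d' d : ℕ} (hd' : 0 < d') (hdvd : d' ∣ d) :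
    {t : ℕ | 0 < t ∧ ∀ S : Multiset G, (∀ g ∈ S, d • g = 0) → t ≤ Multiset.card S →
      ∃ S' ≤ S, S' ≠ 0 ∧ Multiset.card S' ≤ d' ∧ (d / d') • S'.sum = 0}.Nonempty := by
  classical
  have := Fintype.ofFinite G
  refine ⟨Fintype.card G * d', Nat.mul_pos Fintype.card_pos hd', fun S hS hcard => ?_⟩
  obtain ⟨g, hg⟩ : ∃ g, d' ≤ S.count g := by
    by_contra! hlt
    have : Multiset.card S < Fintype.card G * d' := by
      rw [← Multiset.sum_count_eq_card (s := Finset.univ) fun a _ => Finset.mem_univ a]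
      calc ∑ a : G, S.count a < ∑ _a : G, d' :=
            Finset.sum_lt_sum_of_nonempty Finset.univ_nonempty fun a _ => hlt a
        _ = Fintype.card G * d' := by simp
    omega
  refine ⟨Multiset.replicate d' g, Multiset.le_count_iff_replicate_le.1 hg, ?_, by simp, ?_⟩
  · rw [← Multiset.card_pos]
    simpa using hd'
  · rw [Multiset.sum_replicate, ← mul_nsmul', Nat.div_mul_cancel hdvd]
    exact hS g (Multiset.count_pos.1 (hd'.trans_le hg))

theorem etaDD_spec [Finite G] {d' d : ℕ} (hd' : 0 < d') (hdvd : d' ∣ d) :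
    0 < etaDD G d' d ∧ ∀ S : Multiset G, (∀ g ∈ S, d • g = 0) →
      etaDD G d' d ≤ Multiset.card S →
      ∃ S' ≤ S, S' ≠ 0 ∧ Multiset.card S' ≤ d' ∧ (d / d') • S'.sum = 0 :=
  Nat.sInf_mem (etaDD_set_nonempty hd' hdvd)

/-- A sequence with many elements of order `d` contains at least two elements of order `d` that
can be merged into their sum without decreasing the cross number. -/
theorem exists_mergeable_of_etaDD_le [Finite G] {d : ℕ} (hd : 1 < d) {S : Multiset G}
    (hS : etaDD G d.minFac d ≤ S.countP fun g => addOrderOf g = d) :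
    ∃ A ≤ S, 1 < Multiset.card A ∧ crossNum A ≤ 1 / (addOrderOf A.sum : ℝ) := by
  have hp : d.minFac.Prime := Nat.minFac_prime hd.ne'
  have hdvd := d.minFac_dvd
  rw [Multiset.countP_eq_card_filter] at hS
  obtain ⟨A, hA, hA0, hAcard, hAsum⟩ := (etaDD_spec hp.pos hdvd).2 _
    (fun g hg => by
      rw [← (Multiset.mem_filter.1 hg).2]
      exact addOrderOf_nsmul_eq_zero g) hS
  have hord : ∀ g ∈ A, addOrderOf g = d := fun g hg =>
    (Multiset.mem_filter.1 (Multiset.mem_of_le hA hg)).2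
  have hquot : 0 < d / d.minFac := Nat.div_pos (Nat.le_of_dvd (by omega) hdvd) hp.pos
  refine ⟨A, hA.trans (Multiset.filter_le _ _), ?_, ?_⟩
  · by_contra! hle
    have hone : Multiset.card A = 1 := le_antisymm hle (Multiset.card_pos.2 hA0)
    obtain ⟨g, rfl⟩ := Multiset.card_eq_one.1 hone
    rw [Multiset.sum_singleton] at hAsum
    have hle := Nat.le_of_dvd hquot (addOrderOf_dvd_of_nsmul_eq_zero hAsum)
    rw [hord g (Multiset.mem_singleton_self g)] at hle
    exact absurd (Nat.div_lt_self (by omega) hp.one_lt) hle.not_gt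
  · have hpos : 0 < addOrderOf A.sum := addOrderOf_pos A.sum
    have hle := Nat.le_of_dvd hquot (addOrderOf_dvd_of_nsmul_eq_zero hAsum)
    have hmul : Multiset.card A * addOrderOf A.sum ≤ d :=
      (Nat.mul_le_mul hAcard hle).trans (Nat.mul_div_cancel' hdvd).le
    rw [crossNum_eq_card_div hord, div_le_div_iff₀ (by positivity) (by positivity), one_mul]
    exact_mod_cast hmul

theorem crossNum_le_of_no_isTinyZS [Finite G] (S : Multiset G)
    (hS : ¬ ∃ S' ≤ S, IsTinyZS S') :
    crossNum S ≤ ∑ d ∈ (AddMonoid.exponent G).divisors.filter (fun d => 1 < d),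
      ((etaDD G d.minFac d : ℝ) - 1) / (d : ℝ) := by
  induction hm : Multiset.card S using Nat.strong_induction_on generalizing S with
  | _ m ih =>
  subst hm
  by_cases hex : ∃ d, 1 < d ∧ etaDD G d.minFac d ≤ S.countP fun g => addOrderOf g = d
  · obtain ⟨d, hd, hle⟩ := hex
    obtain ⟨A, hAS, hAcard, hAk⟩ := exists_mergeable_of_etaDD_le hd hle
    obtain ⟨B, rfl⟩ := Multiset.le_iff_exists_add.1 hAS
    have hA0 : A ≠ 0 := Multiset.card_pos.1 (by omega)
    have hmerge := ih _ (by rw [Multiset.card_cons, Multiset.card_add]; omega) (A.sum ::ₘ B)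
      (fun h => hS (exists_isTinyZS_of_sum_cons hA0 hAk h)) rfl
    rw [crossNum_cons] at hmerge
    rw [crossNum_add]
    linarith
  · push Not at hex
    rw [crossNum_eq_sum_countP ((AddMonoid.exponent G).divisors.filter fun d => 1 < d) S]
    · refine Finset.sum_le_sum fun d hd => ?_
      have hlt := hex d (Finset.mem_filter.1 hd).2
      have hcast : ((S.countP fun g => addOrderOf g = d : ℕ) : ℝ) + 1 ≤ etaDD G d.minFac d := by
        exact_mod_cast hlt
      gcongr
      linarith
    · intro g hg
      have hg0 : g ≠ 0 := by
        rintro rfl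
        exact hS ⟨{0}, Multiset.singleton_le.2 hg, isTinyZS_singleton_zero⟩
      have hone : addOrderOf g ≠ 1 := mt AddMonoid.addOrderOf_eq_one_iff.1 hg0
      have hpos := addOrderOf_pos g
      exact Finset.mem_filter.2 ⟨Nat.mem_divisors.2
        ⟨AddMonoid.addOrder_dvd_exponent g, AddMonoid.exponent_ne_zero_of_finite⟩, by omega⟩

end CrossNumber

/-- `ρ(G) ≤ ∑_{d ∣ n, d > 1} (η_{(P⁻(d),d)}(G) - 1) / d`, where `n = exp(G)` and
`P⁻(d)` is the smallest prime divisor of `d`. -/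
theorem stmt7 (G : Type*) [AddCommGroup G] [Fintype G]
    (n : ℕ) (hn : AddMonoid.exponent G = n) :
    rhoC G ≤ ∑ d ∈ n.divisors.filter (fun d => 1 < d),
      ((etaDD G d.minFac d : ℝ) - 1) / (d : ℝ) := by
  subst hn
  refine csSup_le ⟨crossNum (0 : Multiset G), 0, ?_, rfl⟩ ?_
  · rintro ⟨S', hle, hne, -⟩
    exact hne (Multiset.le_zero.1 hle)
  · rintro _ ⟨S, hS, rfl⟩
    exact crossNum_le_of_no_isTinyZS S hS
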